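/- arXiv:2212.05779 — 3 statements merged into one kernel-verified Lean document; each statement's English description precedes it below -/
import Mathlib

section
/- Let A be a real skew-symmetric matrix of size 2n × 2n. Then there exist a real orthogonal 2n × 2n matrix W (W^T W = 1) and real numbers λ_0, …, λ_{n−1} such that A = W^T S W, where S is the block-diagonal real matrix whose only nonzero entries are S(2k, 2k+1) = λ_k and S(2k+1, 2k) = −λ_k for 0 ≤ k < n. -/
open Matrix

/-- The canonical block-diagonal skew-symmetric form: `n` diagonal `2 × 2` blocks
`[[0, λ_k], [-λ_k, 0]]`. -/
noncomputable def canonicalBlockForm (n : ℕ) (lam : Fin n → ℝ) :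
    Matrix (Fin (2 * n)) (Fin (2 * n)) ℝ :=
  Matrix.of fun k l : Fin (2 * n) =>
    if h : k.val % 2 = 0 ∧ l.val = k.val + 1 then lam ⟨k.val / 2, by omega⟩
    else if h' : l.val % 2 = 0 ∧ k.val = l.val + 1 then -lam ⟨l.val / 2, by omega⟩
    else 0

lemma skew_step {V : Type} [NormedAddCommGroup V] [InnerProductSpace ℝ V]
    [FiniteDimensional ℝ V] (T : V →ₗ[ℝ] V)
    (hT : ∀ x y, inner ℝ (T x) y = - inner ℝ x (T y)) (h0 : T ≠ 0) :
    ∃ (u v : V) (l : ℝ), inner ℝ u u = 1 ∧ inner ℝ v v = 1 ∧ inner ℝ u v = 0 ∧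
      T v = l • u ∧ T u = -(l • v) := by
  have hsym : (T ∘ₗ T).IsSymmetric := by
    intro x y
    simp [hT]
  have hself : ∀ x, inner ℝ x (T x) = 0 := by
    intro x
    have := hT x x
    rw [real_inner_comm] at this
    linarith
  obtain ⟨u, m, hu1, hu2, hu3⟩ : ∃ (u : V) (m : ℝ), inner ℝ u u = 1 ∧ T (T u) = m • u ∧ T u ≠ 0 := by
    by_contra! hcon
    apply h0
    refine (hsym.eigenvectorBasis rfl).toBasis.ext fun i => ?_
    have := hcon (hsym.eigenvectorBasis rfl i) (hsym.eigenvalues rfl i)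
      (by simp) (hsym.apply_eigenvectorBasis rfl i)
    simpa using this
  have hn : ‖T u‖ ≠ 0 := norm_ne_zero_iff.mpr hu3
  have hm : m = -(‖T u‖ * ‖T u‖) := by
    have := hT u (T u)
    rw [hu2, inner_smul_right, hu1, real_inner_self_eq_norm_mul_norm] at this
    linarith
  refine ⟨u, ‖T u‖⁻¹ • T u, -‖T u‖, hu1, ?_, ?_, ?_, ?_⟩
  · rw [inner_smul_left, inner_smul_right, real_inner_self_eq_norm_mul_norm]
    simp
    field_simp
  · rw [inner_smul_right, hself, mul_zero]
  · rw [map_smul, hu2, hm, smul_smul]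
    congr 1
    field_simp
  · rw [smul_smul, neg_mul, mul_inv_cancel₀ hn]
    simp

lemma skew_main (n : ℕ) : ∀ (V : Type) [NormedAddCommGroup V] [InnerProductSpace ℝ V]
    [FiniteDimensional ℝ V] (_ : Module.finrank ℝ V = 2 * n) (T : V →ₗ[ℝ] V)
    (_ : ∀ x y, inner ℝ (T x) y = - inner ℝ x (T y)),
    ∃ (e f : Fin n → V) (l : Fin n → ℝ),
      (∀ i j, inner ℝ (e i) (e j) = if i = j then (1:ℝ) else 0) ∧
      (∀ i j, inner ℝ (f i) (f j) = if i = j then (1:ℝ) else 0) ∧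
      (∀ i j, inner ℝ (e i) (f j) = (0:ℝ)) ∧
      (∀ i, T (f i) = l i • e i) ∧ (∀ i, T (e i) = -(l i • f i)) := by
  induction n with
  | zero =>
    intro V _ _ _ _ T _
    exact ⟨fun i => i.elim0, fun i => i.elim0, fun i => i.elim0, fun i => i.elim0,
      fun i => i.elim0, fun i => i.elim0, fun i => i.elim0, fun i => i.elim0⟩
  | succ n ih =>
    intro V _ _ _ hV T hT
    by_cases h0 : T = 0
    · subst h0
      let b := (stdOrthonormalBasis ℝ V).reindex (finCongr hV)
      have hb : ∀ i j, inner ℝ (b i) (b j) = if i = j then (1:ℝ) else 0 :=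
        orthonormal_iff_ite.mp b.orthonormal
      refine ⟨fun i => b ⟨2 * i.val, by omega⟩, fun i => b ⟨2 * i.val + 1, by omega⟩, 0,
        ?_, ?_, ?_, by simp, by simp⟩
      · intro i j
        simp [hb, Fin.ext_iff]
      · intro i j
        simp [hb, Fin.ext_iff]
      · intro i j
        rw [hb, if_neg]
        simp only [Fin.ext_iff]
        omega
    · obtain ⟨u, v, l, huu, hvv, huv, hTv, hTu⟩ := skew_step T hT h0
      have hvu : inner ℝ v u = (0:ℝ) := by rw [real_inner_comm]; exact huv
      let U : Submodule ℝ V := Submodule.span ℝ {u, v}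
      have memU : ∀ x, x ∈ Uᗮ ↔ inner ℝ u x = (0:ℝ) ∧ inner ℝ v x = (0:ℝ) := by
        intro x
        constructor
        · intro h
          exact ⟨(Submodule.mem_orthogonal U x).mp h u (Submodule.subset_span (by simp)),
            (Submodule.mem_orthogonal U x).mp h v (Submodule.subset_span (by simp))⟩
        · rintro ⟨h1, h2⟩
          rw [Submodule.mem_orthogonal]
          intro y hy
          obtain ⟨a, b, rfl⟩ := Submodule.mem_span_pair.mp hy
          simp [inner_add_left, inner_smul_left, h1, h2]
      have hfU : Module.finrank ℝ U = 2 := by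
        have hon : Orthonormal ℝ ![u, v] := by
          rw [orthonormal_iff_ite]
          intro i j
          fin_cases i <;> fin_cases j <;> simp [huu, hvv, huv, hvu
            , -inner_self_eq_norm_sq_to_K]
        have := finrank_span_eq_card hon.linearIndependent
        rw [Matrix.range_cons, Matrix.range_cons, Matrix.range_empty, Set.union_empty,
          Set.singleton_union] at this
        simpa [U] using this
      have hfO : Module.finrank ℝ Uᗮ = 2 * n := by
        have := U.finrank_add_finrank_orthogonal
        omega
      have hinv : ∀ x ∈ Uᗮ, T x ∈ Uᗮ := by
        intro x hx
        rw [memU] at hx ⊢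
        have h1 := hT u x
        have h2 := hT v x
        rw [hTu, inner_neg_left, inner_smul_left, hx.2] at h1
        rw [hTv, inner_smul_left, hx.1] at h2
        constructor <;> simp at h1 h2 <;> linarith
      obtain ⟨e, f, m, hee, hff, hef, hTf, hTe⟩ := ih Uᗮ hfO (T.restrict hinv)
        (fun x y => by simpa using hT x y)
      have hue := fun i => (memU _).mp (e i).2
      have huf := fun i => (memU _).mp (f i).2
      refine ⟨Fin.cons u (fun i => (e i : V)), Fin.cons v (fun i => (f i : V)), Fin.cons l m,
        ?_, ?_, ?_, ?_, ?_⟩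
      · intro i j
        cases i using Fin.cases with
        | zero =>
          cases j using Fin.cases with
          | zero => simpa only [Fin.cons_zero, if_true] using huu
          | succ j => simpa [(Fin.succ_ne_zero j).symm] using (hue j).1
        | succ i =>
          cases j using Fin.cases with
          | zero =>
            rw [real_inner_comm]
            simpa using (hue i).1
          | succ j => simpa using hee i j
      · intro i j
        cases i using Fin.cases with
        | zero =>
          cases j using Fin.cases with
          | zero => simpa only [Fin.cons_zero, if_true] using hvv
          | succ j => simpa [(Fin.succ_ne_zero j).symm] using (huf j).2
        | succ i =>
          cases j using Fin.cases with
          | zero =>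
            rw [real_inner_comm]
            simpa using (huf i).2
          | succ j => simpa using hff i j
      · intro i j
        cases i using Fin.cases with
        | zero =>
          cases j using Fin.cases with
          | zero => simpa using huv
          | succ j => simpa using (huf j).1
        | succ i =>
          cases j using Fin.cases with
          | zero =>
            rw [real_inner_comm]
            simpa using (hue i).2
          | succ j => simpa using hef i j
      · intro i
        cases i using Fin.cases with
        | zero => simpa using hTv
        | succ i => simpa using congrArg Subtype.val (hTf i)
      · intro i
        cases i using Fin.cases with
        | zero => simpa using hTu
        | succ i => simpa using congrArg Subtype.val (hTe i)

/-- Every real skew-symmetric `2n × 2n` matrix `A` can be written as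
`A = Wᵀ S W` with `W` real orthogonal and `S` the canonical block-diagonal form. -/
theorem skew_symmetric_canonical_decomposition
    (n : ℕ) (A : Matrix (Fin (2 * n)) (Fin (2 * n)) ℝ) (hA : Aᵀ = -A) :
    ∃ (W : Matrix (Fin (2 * n)) (Fin (2 * n)) ℝ) (lam : Fin n → ℝ),
      Wᵀ * W = 1 ∧ A = Wᵀ * canonicalBlockForm n lam * W := by
  have hin : ∀ x y : EuclideanSpace ℝ (Fin (2 * n)), inner ℝ x y = x.ofLp ⬝ᵥ y.ofLp := by
    intro x y
    rw [EuclideanSpace.inner_eq_star_dotProduct, dotProduct_comm]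
    simp
  obtain ⟨e, f, l, hee, hff, hef, hTf, hTe⟩ :=
    skew_main n (EuclideanSpace ℝ (Fin (2 * n))) (by simp) (Matrix.toEuclideanLin A) (by
      intro x y
      rw [hin, hin, Matrix.ofLp_toEuclideanLin_apply, Matrix.ofLp_toEuclideanLin_apply,
        Matrix.dotProduct_mulVec, ← Matrix.mulVec_transpose, hA, Matrix.neg_mulVec,
        neg_dotProduct, neg_neg])
  have hfe : ∀ i j, inner ℝ (f i) (e j) = (0:ℝ) := fun i j => by
    rw [real_inner_comm]; exact hef j i
  let b : Fin (2 * n) → EuclideanSpace ℝ (Fin (2 * n)) := fun i =>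
    if i.val % 2 = 0 then e ⟨i.val / 2, by omega⟩ else f ⟨i.val / 2, by omega⟩
  let W : Matrix (Fin (2 * n)) (Fin (2 * n)) ℝ := Matrix.of fun i => (b i).ofLp
  have hW : W * Wᵀ = 1 := by
    ext i j
    have h1 : (W * Wᵀ) i j = inner ℝ (b i) (b j) := by
      rw [hin]; rfl
    rw [h1, Matrix.one_apply]
    by_cases hi : i.val % 2 = 0 <;> by_cases hj : j.val % 2 = 0 <;>
      simp only [b, hi, hj, if_true, if_false, hee, hff, hef, hfe, Fin.ext_iff] <;>
      split_ifs <;> first | rfl | omega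
  have hW' : Wᵀ * W = 1 := mul_eq_one_comm.mp hW
  have hS : W * A * Wᵀ = canonicalBlockForm n l := by
    ext i j
    have h1 : (W * A * Wᵀ) i j = inner ℝ (b i) (Matrix.toEuclideanLin A (b j)) := by
      rw [hin, Matrix.ofLp_toEuclideanLin_apply, Matrix.mul_assoc]; rfl
    rw [h1]
    simp only [canonicalBlockForm, Matrix.of_apply]
    by_cases hi : i.val % 2 = 0 <;> by_cases hj : j.val % 2 = 0 <;>
      simp only [b, hi, hj, if_true, if_false, hTe, hTf, inner_neg_right, inner_smul_right,
        hee, hff, hef, hfe, Fin.ext_iff, true_and, false_and] <;>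
      split_ifs <;> first | contradiction | omega | simp | skip
    all_goals first | (congr 2; omega) | (congr 3; omega) | skip
  refine ⟨W, l, hW', ?_⟩
  rw [← hS]
  calc A = (Wᵀ * W) * A * (Wᵀ * W) := by rw [hW']; simp
    _ = _ := by simp only [Matrix.mul_assoc]
end

section
/- Let A be an associative unital ℂ-algebra and let c : Fin (2n) → A satisfy the Clifford anticommutation relations c_k c_l + c_l c_k = 2 δ_{kl} · 1. Let W be a real orthogonal 2n × 2n matrix, let λ_0, …, λ_{n−1} be real numbers, and let A_mat = W^T S W where S is the real matrix whose only nonzero entries are S(2k, 2k+1) = λ_k and S(2k+1, 2k) = −λ_k. Define b_k = Σ_j W(k,j) · c_j. Then (i/4) · Σ_{k,l} A_mat(k,l) · (c_k c_l) = (i/2) · Σ_{j=0}^{n−1} λ_j · (b_{2j} b_{2j+1}). -/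
open Matrix

theorem even_lt_aux {n : ℕ} (j : Fin n) : 2 * j.val < 2 * n := by
  have := j.isLt
  omega

theorem odd_lt_aux {n : ℕ} (j : Fin n) : 2 * j.val + 1 < 2 * n := by
  have := j.isLt
  omega

theorem sum_pairs_aux {M : Type*} [AddCommMonoid M] (n : ℕ) (g : Fin (2 * n) → M) :
    ∑ p, g p = ∑ j : Fin n,
      (g ⟨2 * j.val, even_lt_aux j⟩ + g ⟨2 * j.val + 1, odd_lt_aux j⟩) := by
  induction n with
  | zero => simp
  | succ n ih =>
    rw [Fin.sum_univ_castSucc (n := n)]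
    have h := Fin.sum_univ_castSucc (n := 2 * n + 1) (f := g)
    have h2 := Fin.sum_univ_castSucc (n := 2 * n) (f := fun i => g (Fin.castSucc i))
    refine (h.trans (congrArg (· + _) h2)).trans ?_
    have h3 := ih (fun i => g (Fin.castSucc (Fin.castSucc i)))
    refine (congrArg (fun x => x + _ + _) h3).trans ?_
    rw [add_assoc]
    rfl

theorem canonicalBlockForm_sum_aux {A : Type*} [Ring A] [Algebra ℂ A] (n : ℕ)
    (lam : Fin n → ℝ) (f : Fin (2 * n) → Fin (2 * n) → A) :
    ∑ p, ∑ q, (canonicalBlockForm n lam p q : ℂ) • f p q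
      = ∑ j : Fin n, (lam j : ℂ) •
        (f ⟨2 * j.val, even_lt_aux j⟩ ⟨2 * j.val + 1, odd_lt_aux j⟩
          - f ⟨2 * j.val + 1, odd_lt_aux j⟩ ⟨2 * j.val, even_lt_aux j⟩) := by
  rw [sum_pairs_aux]
  refine Finset.sum_congr rfl fun j _ => ?_
  rw [Finset.sum_eq_single (⟨2 * j.val + 1, odd_lt_aux j⟩ : Fin (2 * n)),
    Finset.sum_eq_single (⟨2 * j.val, even_lt_aux j⟩ : Fin (2 * n))]
  · have e1 : canonicalBlockForm n lam ⟨2 * j.val, even_lt_aux j⟩ ⟨2 * j.val + 1, odd_lt_aux j⟩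
        = lam j := by
      simp [canonicalBlockForm]
    have e2 : canonicalBlockForm n lam ⟨2 * j.val + 1, odd_lt_aux j⟩ ⟨2 * j.val, even_lt_aux j⟩
        = - lam j := by
      simp [canonicalBlockForm, Nat.add_mod]
    rw [e1, e2, smul_sub, Complex.ofReal_neg, neg_smul, sub_eq_add_neg]
  · intro q _ hq
    have : canonicalBlockForm n lam ⟨2 * j.val + 1, odd_lt_aux j⟩ q = 0 := by
      have hq' : q.val ≠ 2 * j.val := fun h => hq (Fin.ext h)
      simp only [canonicalBlockForm, Matrix.of_apply]
      rw [dif_neg (by omega), dif_neg (by omega)]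
    rw [this]; simp
  · simp
  · intro q _ hq
    have : canonicalBlockForm n lam ⟨2 * j.val, even_lt_aux j⟩ q = 0 := by
      have hq' : q.val ≠ 2 * j.val + 1 := fun h => hq (Fin.ext h)
      simp only [canonicalBlockForm, Matrix.of_apply]
      rw [dif_neg (by omega), dif_neg (by omega)]
    rw [this]; simp
  · simp

/-- The canonical Fermionic block-diagonal transformation: for a family
`c` satisfying the Clifford relations and `A_mat = Wᵀ S W` with `W` orthogonal and `S`
canonical block-diagonal, the quadratic Hamiltonian
`(i/4) Σ_{k,l} A_mat(k,l) c_k c_l` equals `(i/2) Σ_j λ_j b_{2j} b_{2j+1}`,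
where `b_k = Σ_j W(k,j) c_j`. -/
theorem quadratic_hamiltonian_block_diagonalization
    {A : Type*} [Ring A] [Algebra ℂ A] (n : ℕ)
    (c : Fin (2 * n) → A)
    (hc : ∀ k l : Fin (2 * n), c k * c l + c l * c k = if k = l then (2 : A) else 0)
    (W : Matrix (Fin (2 * n)) (Fin (2 * n)) ℝ) (hW : Wᵀ * W = 1)
    (lam : Fin n → ℝ)
    (Amat : Matrix (Fin (2 * n)) (Fin (2 * n)) ℝ)
    (hAmat : Amat = Wᵀ * canonicalBlockForm n lam * W)
    (b : Fin (2 * n) → A) (hb : ∀ k, b k = ∑ j, (W k j : ℂ) • c j) :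
    (Complex.I / 4) • ∑ k : Fin (2 * n), ∑ l : Fin (2 * n), (Amat k l : ℂ) • (c k * c l)
      = (Complex.I / 2) • ∑ j : Fin n,
          (lam j : ℂ) • (b ⟨2 * j.val, by omega⟩ * b ⟨2 * j.val + 1, by omega⟩) := by
  have hmul : ∀ p q, b p * b q = ∑ k, ∑ l, ((W p k : ℂ) * (W q l : ℂ)) • (c k * c l) := by
    intro p q
    rw [hb, hb, Finset.sum_mul_sum]
    refine Finset.sum_congr rfl fun k _ => Finset.sum_congr rfl fun l _ => ?_
    rw [smul_mul_smul_comm]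
  have h1 : ∑ k, ∑ l, (Amat k l : ℂ) • (c k * c l)
      = ∑ p, ∑ q, (canonicalBlockForm n lam p q : ℂ) • (b p * b q) := by
    have hA : ∀ k l, (Amat k l : ℂ) = ∑ p, ∑ q,
        (canonicalBlockForm n lam p q : ℂ) * ((W p k : ℂ) * (W q l : ℂ)) := by
      intro k l
      rw [hAmat, Matrix.mul_apply, Finset.sum_comm]
      simp only [Matrix.mul_apply, Matrix.transpose_apply, Finset.sum_mul]
      push_cast
      refine Finset.sum_congr rfl fun q _ => Finset.sum_congr rfl fun p _ => ?_
      ring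
    simp only [hA, hmul, Finset.sum_smul, Finset.smul_sum, smul_smul]
    calc _ = ∑ k, ∑ p, ∑ l, ∑ q, ((canonicalBlockForm n lam p q : ℂ)
              * ((W p k : ℂ) * (W q l : ℂ))) • (c k * c l) :=
          Finset.sum_congr rfl fun k _ => Finset.sum_comm
      _ = ∑ p, ∑ k, ∑ l, ∑ q, ((canonicalBlockForm n lam p q : ℂ)
              * ((W p k : ℂ) * (W q l : ℂ))) • (c k * c l) := Finset.sum_comm
      _ = ∑ p, ∑ k, ∑ q, ∑ l, ((canonicalBlockForm n lam p q : ℂ)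
              * ((W p k : ℂ) * (W q l : ℂ))) • (c k * c l) :=
          Finset.sum_congr rfl fun p _ => Finset.sum_congr rfl fun k _ => Finset.sum_comm
      _ = _ := Finset.sum_congr rfl fun p _ => Finset.sum_comm
  have hW2 : W * Wᵀ = 1 := mul_eq_one_comm.mp hW
  have hanti : ∀ p q, p ≠ q → b p * b q + b q * b p = 0 := by
    intro p q hpq
    have hz : ∑ k, (W p k : ℂ) * (W q k : ℂ) = 0 := by
      have := congrFun (congrFun hW2 p) q
      rw [Matrix.mul_apply, Matrix.one_apply_ne hpq] at this
      simp only [Matrix.transpose_apply] at this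
      exact_mod_cast this
    rw [hmul p q, hmul q p, Finset.sum_comm (s := Finset.univ) (t := Finset.univ)
      (f := fun k l => ((W q k : ℂ) * (W p l : ℂ)) • (c k * c l)), ← Finset.sum_add_distrib]
    calc _ = ∑ k, ∑ l, ((W p k : ℂ) * (W q l : ℂ)) • (if k = l then (2 : A) else 0) := by
          refine Finset.sum_congr rfl fun k _ => ?_
          rw [← Finset.sum_add_distrib]
          refine Finset.sum_congr rfl fun l _ => ?_
          rw [← hc k l, smul_add, mul_comm (W q l : ℂ)]
      _ = (∑ k, (W p k : ℂ) * (W q k : ℂ)) • (2 : A) := by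
          simp [Finset.sum_smul]
      _ = 0 := by rw [hz, zero_smul]
  rw [h1, canonicalBlockForm_sum_aux n lam (fun p q => b p * b q), Finset.smul_sum,
    Finset.smul_sum]
  refine Finset.sum_congr rfl fun j _ => ?_
  have hj := hanti ⟨2 * j.val, by omega⟩ ⟨2 * j.val + 1, by omega⟩ (by simp [Fin.ext_iff])
  rw [← neg_eq_of_add_eq_zero_right hj, sub_neg_eq_add, ← two_smul ℂ, smul_smul, smul_smul,
    smul_smul]
  congr 1
  ring
end

section
/- Fix N ≥ 1 and indices 0 ≤ i < j < N, let a_i, a_j be the Jordan–Wigner annihilation operators on N qubits, and let c, d be real numbers with b_{ij} = c + d·i ∈ ℂ. Then b_{ij} · (a_i† a_j) + conj(b_{ij}) · (a_j† a_i) = (c/2) · (Y_i Z⋯Z Y_j + X_i Z⋯Z X_j) + (d/2) · (Y_i Z⋯Z X_j − X_i Z⋯Z Y_j), where P_i Z⋯Z Q_j denotes the tensor product with P in slot i, Pauli Z in every slot k with i < k < j, Q in slot j, and the identity in every other slot. -/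
open Matrix

/-- Tensor product of `N` single-qubit matrices, as a matrix indexed by bit strings. -/
noncomputable def tensorProd {N : ℕ} (M : Fin N → Matrix (Fin 2) (Fin 2) ℂ) :
    Matrix (Fin N → Fin 2) (Fin N → Fin 2) ℂ :=
  Matrix.of fun s t => ∏ k, M k (s k) (t k)

/-- Pauli `X`. -/
def pauliX : Matrix (Fin 2) (Fin 2) ℂ := !![0, 1; 1, 0]

/-- Pauli `Y`. -/
def pauliY : Matrix (Fin 2) (Fin 2) ℂ := !![0, -Complex.I; Complex.I, 0]

/-- Pauli `Z`. -/
def pauliZ : Matrix (Fin 2) (Fin 2) ℂ := !![1, 0; 0, -1]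

/-- Jordan–Wigner annihilation operator `a_j` on `N` qubits: `Z` on slots before `j`,
`(X + iY)/2` on slot `j`, identity after. -/
noncomputable def aOp (N : ℕ) (j : Fin N) : Matrix (Fin N → Fin 2) (Fin N → Fin 2) ℂ :=
  tensorProd fun k =>
    if k < j then pauliZ
    else if k = j then (2 : ℂ)⁻¹ • (pauliX + Complex.I • pauliY)
    else 1

/-- `P_j`: single-qubit matrix `P` in slot `j`, identity elsewhere. -/
noncomputable def singleSite (N : ℕ) (j : Fin N) (P : Matrix (Fin 2) (Fin 2) ℂ) :
    Matrix (Fin N → Fin 2) (Fin N → Fin 2) ℂ :=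
  tensorProd fun k => if k = j then P else 1

/-- `P_i Z⋯Z Q_j`: `P` in slot `i`, Pauli `Z` strictly between `i` and `j`, `Q` in
slot `j`, identity elsewhere. -/
noncomputable def pauliString (N : ℕ) (i j : Fin N) (P Q : Matrix (Fin 2) (Fin 2) ℂ) :
    Matrix (Fin N → Fin 2) (Fin N → Fin 2) ℂ :=
  tensorProd fun k =>
    if k = i then P else if k = j then Q else if i < k ∧ k < j then pauliZ else 1


theorem tensorProd_mul {N : ℕ} (A B : Fin N → Matrix (Fin 2) (Fin 2) ℂ) :
    tensorProd A * tensorProd B = tensorProd fun k => A k * B k := by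
  ext s t
  simp only [tensorProd, Matrix.mul_apply, Matrix.of_apply, ← Finset.prod_mul_distrib]
  rw [Finset.prod_univ_sum, Fintype.piFinset_univ]

theorem tensorProd_conjTranspose {N : ℕ} (A : Fin N → Matrix (Fin 2) (Fin 2) ℂ) :
    (tensorProd A)ᴴ = tensorProd fun k => (A k)ᴴ := by
  ext s t
  simp [tensorProd, Matrix.conjTranspose_apply]

theorem pauliString_apply {N : ℕ} (i j : Fin N) (hij : i < j)
    (P Q : Matrix (Fin 2) (Fin 2) ℂ) (s t : Fin N → Fin 2) :
    pauliString N i j P Q s t = P (s i) (t i) * (Q (s j) (t j) *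
      ∏ k ∈ (Finset.univ.erase i).erase j,
        (if i < k ∧ k < j then pauliZ else 1 : Matrix (Fin 2) (Fin 2) ℂ) (s k) (t k)) := by
  simp only [pauliString, tensorProd, Matrix.of_apply]
  rw [← Finset.mul_prod_erase _ _ (Finset.mem_univ i),
    ← Finset.mul_prod_erase _ _ (Finset.mem_erase.2 ⟨hij.ne', Finset.mem_univ j⟩)]
  simp only [if_true, if_neg hij.ne']
  congr 2
  refine Finset.prod_congr rfl fun k hk => ?_
  simp only [Finset.mem_erase] at hk
  rw [if_neg hk.2.1, if_neg hk.1]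

theorem lowering_eq : (2 : ℂ)⁻¹ • (pauliX + Complex.I • pauliY) = !![0, 1; 0, 0] := by
  ext a b
  fin_cases a <;> fin_cases b <;> simp [pauliX, pauliY] <;> norm_num

theorem pauliZ_conj : pauliZᴴ = pauliZ := by
  ext a b
  fin_cases a <;> fin_cases b <;> simp [pauliZ]

theorem pauliZ_sq : pauliZ * pauliZ = 1 := by
  ext a b
  fin_cases a <;> fin_cases b <;> simp [pauliZ]

theorem lowering_conj : (!![0, 1; 0, 0] : Matrix (Fin 2) (Fin 2) ℂ)ᴴ = !![0, 0; 1, 0] := by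
  ext a b
  fin_cases a <;> fin_cases b <;> simp

theorem hop_one {N : ℕ} (i j : Fin N) (hij : i < j) :
    (aOp N i)ᴴ * aOp N j = pauliString N i j !![0, 0; 1, 0] !![0, 1; 0, 0] := by
  simp only [aOp, tensorProd_conjTranspose, tensorProd_mul, pauliString, lowering_eq]
  congr 1
  funext k
  rcases lt_trichotomy k i with h | rfl | h
  · simp [h, h.ne, h.trans hij, (h.trans hij).ne, h.not_gt, pauliZ_conj, pauliZ_sq]
  · simp only [lt_irrefl, if_false, if_true, hij, lowering_conj]
    ext a b
    fin_cases a <;> fin_cases b <;> simp [pauliZ]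
  · rcases lt_trichotomy k j with h' | rfl | h'
    · simp [h, h', h.ne', h'.ne, h.not_gt]
    · simp [h, h.ne', h.not_gt]
    · simp [h.ne', h'.ne', h.not_gt, h'.not_gt]

theorem hop_two {N : ℕ} (i j : Fin N) (hij : i < j) :
    (aOp N j)ᴴ * aOp N i = pauliString N i j !![0, 1; 0, 0] !![0, 0; 1, 0] := by
  simp only [aOp, tensorProd_conjTranspose, tensorProd_mul, pauliString, lowering_eq]
  congr 1
  funext k
  rcases lt_trichotomy k i with h | rfl | h
  · simp [h, h.ne, h.trans hij, (h.trans hij).ne, h.not_gt, pauliZ_conj, pauliZ_sq]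
  · simp only [lt_irrefl, if_false, if_true, hij, pauliZ_conj]
    ext a b
    fin_cases a <;> fin_cases b <;> simp [pauliZ]
  · rcases lt_trichotomy k j with h' | rfl | h'
    · simp [h, h', h.ne', h'.ne, h.not_gt, pauliZ_conj]
    · simp [h.ne', h.not_gt, lowering_conj]
    · simp [h.ne', h'.ne', h.not_gt, h'.not_gt]

/-- For `i < j` and `b_{ij} = c + d·i`, the hopping term
`b_{ij} a_i† a_j + conj(b_{ij}) a_j† a_i` equals
`(c/2)(Y_i Z⋯Z Y_j + X_i Z⋯Z X_j) + (d/2)(Y_i Z⋯Z X_j − X_i Z⋯Z Y_j)`. -/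
theorem jordan_wigner_hopping_term
    (N : ℕ) (hN : 1 ≤ N) (i j : Fin N) (hij : i < j) (c d : ℝ) :
    ((c : ℂ) + (d : ℂ) * Complex.I) • ((aOp N i)ᴴ * aOp N j)
        + (starRingEnd ℂ ((c : ℂ) + (d : ℂ) * Complex.I)) • ((aOp N j)ᴴ * aOp N i)
      = ((c : ℂ) / 2) • (pauliString N i j pauliY pauliY + pauliString N i j pauliX pauliX)
        + ((d : ℂ) / 2) • (pauliString N i j pauliY pauliX - pauliString N i j pauliX pauliY) := by
  rw [hop_one i j hij, hop_two i j hij]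
  ext s t
  simp only [Matrix.add_apply, Matrix.sub_apply, Matrix.smul_apply, smul_eq_mul,
    pauliString_apply i j hij]
  generalize (∏ k ∈ (Finset.univ.erase i).erase j,
        (if i < k ∧ k < j then pauliZ else 1 : Matrix (Fin 2) (Fin 2) ℂ) (s k) (t k)) = R
  generalize s i = p
  generalize t i = q
  generalize s j = u
  generalize t j = v
  have hI : Complex.I ^ 2 = -1 := Complex.I_sq
  fin_cases p <;> fin_cases q <;> fin_cases u <;> fin_cases v <;>
    simp [pauliX, pauliY] <;> grind
end
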